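/- arXiv:1312.7295 — 3 statements merged into one kernel-verified Lean document; each statement's English description precedes it below -/
import Mathlib

section
/- If f(x) is a monic polynomial in ℤ[x] with deg f = d > 1, then there exist monic polynomials g(x) and h(x) in ℤ[x], each irreducible over ℚ (i.e., irreducible as polynomials in ℚ[x]), such that f(x) = g(x) + h(x). -/
/-- A nonempty product of complex numbers outside the closed unit disc lies outside it. -/
theorem Multiset.one_lt_norm_prod {s : Multiset ℂ} (hs : s ≠ 0) (h : ∀ z ∈ s, 1 < ‖z‖) :
    1 < ‖s.prod‖ := by
  induction s using Multiset.induction_on with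
  | empty => exact absurd rfl hs
  | cons a s ih =>
    have ha := h a (Multiset.mem_cons_self a s)
    rw [Multiset.prod_cons, norm_mul]
    by_cases hs' : s = 0
    · simpa [hs'] using ha
    · exact one_lt_mul_of_lt_of_le ha
        (ih hs' fun z hz => h z (Multiset.mem_cons_of_mem hz)).le

/-- A monic integer polynomial of positive degree whose constant coefficient is a unit has a
complex root in the closed unit disc. -/
theorem Polynomial.Monic.exists_aeval_eq_zero_norm_le_one {a : Polynomial ℤ} (ha : a.Monic)
    (hdeg : a.natDegree ≠ 0) (hunit : IsUnit (a.coeff 0)) :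
    ∃ z : ℂ, Polynomial.aeval z a = 0 ∧ ‖z‖ ≤ 1 := by
  set A := a.map (Int.castRingHom ℂ) with hA
  have hAm : A.Monic := ha.map _
  have hAd : A.natDegree = a.natDegree := ha.natDegree_map _
  have hsplit : A.Splits := IsAlgClosed.splits A
  by_contra! hroots
  have hlt : 1 < ‖A.roots.prod‖ := by
    refine Multiset.one_lt_norm_prod (fun h0 => hdeg ?_) fun z hz => hroots z ?_
    · rw [← hAd, hsplit.natDegree_eq_card_roots, h0, Multiset.card_zero]
    · have := Polynomial.isRoot_of_mem_roots hz
      rwa [Polynomial.IsRoot, hA, Polynomial.eval_map, ← algebraMap_int_eq,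
        ← Polynomial.aeval_def] at this
  have hcoeff := congrArg norm (hsplit.coeff_zero_eq_prod_roots_of_monic hAm)
  rw [norm_mul, norm_pow, norm_neg, norm_one, one_pow, one_mul] at hcoeff
  rw [← hcoeff, hA, Polynomial.coeff_map] at hlt
  rcases Int.isUnit_iff.1 hunit with h | h <;> simp [h] at hlt

/-- If the constant coefficient dominates the sum of the others, there is no root in the closed
unit disc. -/
theorem Polynomial.one_lt_norm_of_aeval_eq_zero {p : Polynomial ℤ}
    (hp : ∑ i ∈ Finset.range p.natDegree, |p.coeff (i + 1)| < |p.coeff 0|)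
    {z : ℂ} (hz : Polynomial.aeval z p = 0) : 1 < ‖z‖ := by
  by_contra! hle
  rw [Polynomial.aeval_eq_sum_range, Finset.sum_range_succ', pow_zero] at hz
  have hnorm : ‖(p.coeff 0 : ℂ)‖ ≤ ∑ i ∈ Finset.range p.natDegree, |(p.coeff (i + 1) : ℝ)| := by
    rw [zsmul_one] at hz
    rw [eq_neg_of_add_eq_zero_right hz, norm_neg]
    refine (norm_sum_le _ _).trans (Finset.sum_le_sum fun i _ => ?_)
    rw [zsmul_eq_mul, norm_mul, norm_pow, Complex.norm_intCast]
    exact mul_le_of_le_one_right (abs_nonneg _) (pow_le_one₀ (norm_nonneg _) hle)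
  rw [Complex.norm_intCast] at hnorm
  exact absurd hp (not_lt.2 (by exact_mod_cast hnorm))

/-- A monic integer polynomial whose constant coefficient is prime and dominates the sum of the
other coefficients is irreducible. -/
theorem Polynomial.Monic.irreducible_of_prime_coeff_zero {p : Polynomial ℤ} (hm : p.Monic)
    (hprime : Prime (p.coeff 0))
    (hp : ∑ i ∈ Finset.range p.natDegree, |p.coeff (i + 1)| < |p.coeff 0|) :
    Irreducible p := by
  have hroot : ∀ a : Polynomial ℤ, a.Monic → a ∣ p → IsUnit (a.coeff 0) → a.natDegree = 0 := by
    intro a ha hdvd hunit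
    by_contra hdeg
    obtain ⟨z, hz, hle⟩ := ha.exists_aeval_eq_zero_norm_le_one hdeg hunit
    exact absurd (Polynomial.one_lt_norm_of_aeval_eq_zero hp
      (Polynomial.aeval_eq_zero_of_dvd_aeval_eq_zero hdvd hz)) (not_lt.2 hle)
  refine (hm.irreducible_iff_natDegree).2 ⟨fun h1 => ?_, fun a b ha hb hab => ?_⟩
  · exact hprime.not_isUnit (by simp [h1])
  · have hc : p.coeff 0 = a.coeff 0 * b.coeff 0 := by
      rw [← hab, Polynomial.mul_coeff_zero]
    exact (hprime.irreducible.isUnit_or_isUnit hc).imp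
      (hroot a ha (Dvd.intro _ hab)) (hroot b hb (Dvd.intro_left _ hab))

/-- Hayes' theorem: every monic integer polynomial of degree `d > 1` is a sum of two
monic integer polynomials which are irreducible over `ℚ`. -/
theorem goldbach_monic_int_poly (f : Polynomial ℤ) (hf : f.Monic) (hdeg : 1 < f.natDegree) :
    ∃ g h : Polynomial ℤ, g.Monic ∧ h.Monic ∧
      Irreducible (g.map (Int.castRingHom ℚ)) ∧ Irreducible (h.map (Int.castRingHom ℚ)) ∧
      f = g + h := by
  set p := f - Polynomial.X with hp
  have hX : (Polynomial.X : Polynomial ℤ).degree < f.degree := by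
    rw [Polynomial.degree_X]
    rw [Polynomial.degree_eq_natDegree hf.ne_zero]
    exact_mod_cast hdeg
  obtain ⟨q, hq, hqp⟩ := Nat.exists_infinite_primes
    ((∑ i ∈ Finset.range f.natDegree, |p.coeff (i + 1)|).toNat + 1)
  set g := p + Polynomial.C (q - p.coeff 0) with hg
  have hpd : p.degree = f.degree := Polynomial.degree_sub_eq_left_of_degree_lt hX
  have hpm : p.Monic := hf.sub_of_left hX
  have hgp : (Polynomial.C ((q : ℤ) - p.coeff 0)).degree < p.degree :=
    Polynomial.degree_C_le.trans_lt (by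
      rw [hpd, Polynomial.degree_eq_natDegree hf.ne_zero]; exact_mod_cast hdeg.trans' one_pos)
  have hgm : g.Monic := hpm.add_of_left hgp
  have hgd : g.natDegree = f.natDegree :=
    Polynomial.natDegree_eq_of_degree_eq ((Polynomial.degree_add_eq_left_of_degree_lt hgp).trans hpd)
  have hg0 : g.coeff 0 = q := by simp [hg]
  have hgi : Irreducible g := by
    refine hgm.irreducible_of_prime_coeff_zero (hg0 ▸ Nat.prime_iff_prime_int.1 hqp) ?_
    have hsucc : ∀ i, g.coeff (i + 1) = p.coeff (i + 1) := fun i => by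
      rw [hg, Polynomial.coeff_add, Polynomial.coeff_C_succ, add_zero]
    simp only [hgd, hsucc, hg0, Nat.abs_cast]
    omega
  have hhm : (Polynomial.X - Polynomial.C ((q : ℤ) - p.coeff 0)).Monic :=
    Polynomial.monic_X_sub_C _
  refine ⟨g, Polynomial.X - Polynomial.C (q - p.coeff 0), hgm, hhm,
    (hgm.irreducible_iff_irreducible_map_fraction_map (K := ℚ)).1 hgi, ?_, ?_⟩
  · rw [Polynomial.map_sub, Polynomial.map_X, Polynomial.map_C]
    exact Polynomial.irreducible_X_sub_C _
  · rw [hg, hp]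
    ring
end

section
/- Suppose D is an integral domain which is Noetherian and has infinitely many maximal ideals. Then every polynomial f(x) ∈ D[x] of degree d ≥ 1 can be written as f(x) = g(x) + h(x), where g(x) and h(x) are irreducible elements of the ring D[x]. -/
open Polynomial in
/-- Eisenstein's criterion for a monic polynomial whose lower part is, up to a constant term in
`P \ P ^ 2`, divisible by an element of `P ^ 2`. -/
theorem Polynomial.irreducible_X_pow_add_C_mul_add_C {D : Type*} [CommRing D] [IsDomain D]
    {P : Ideal D} (hP : P.IsPrime) {p c : D} (hp : p ∈ P ^ 2) (hc : c ∈ P) (hc2 : c ∉ P ^ 2)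
    (f : D[X]) : Irreducible (X ^ (f.natDegree + 1) + (C p * f + C c)) := by
  have hdeg : (C p * f + C c).degree < ((f.natDegree + 1 : ℕ) : WithBot ℕ) := by
    have hle : (C p * f + C c).natDegree ≤ f.natDegree :=
      natDegree_add_C.trans_le (natDegree_C_mul_le p f)
    exact (degree_le_of_natDegree_le hle).trans_lt (Nat.cast_lt.2 (Nat.lt_succ_self _))
  have hmonic := monic_X_pow_add hdeg
  have hd : (X ^ (f.natDegree + 1) + (C p * f + C c)).degree =
      ((f.natDegree + 1 : ℕ) : WithBot ℕ) := by
    rw [degree_add_eq_left_of_degree_lt (by rwa [degree_X_pow]), degree_X_pow]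
  have hpP : p ∈ P := Ideal.pow_le_self two_ne_zero hp
  refine irreducible_of_eisenstein_criterion hP ?_ (fun n hn ↦ ?_) ?_ ?_ hmonic.isPrimitive
  · rw [hmonic.leadingCoeff]
    exact fun h ↦ hP.ne_top ((Ideal.eq_top_iff_one _).2 h)
  · rw [hd] at hn
    have hn' : n ≠ f.natDegree + 1 := (Nat.cast_lt.1 hn).ne
    rw [coeff_add, coeff_X_pow, if_neg hn', zero_add, coeff_add, coeff_C_mul, coeff_C]
    refine P.add_mem (P.mul_mem_right _ hpP) ?_
    split_ifs
    exacts [hc, P.zero_mem]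
  · rw [hd]
    exact_mod_cast Nat.succ_pos _
  · intro h
    simp only [coeff_add, coeff_X_pow, coeff_C_mul, coeff_C_zero,
      (Nat.succ_ne_zero f.natDegree).symm, if_false, zero_add] at h
    exact hc2 (((P ^ 2).add_mem_iff_right ((P ^ 2).mul_mem_right _ hp)).1 h)

/-- A proper nonzero ideal of a Noetherian domain is not contained in its square. -/
theorem Ideal.exists_mem_notMem_sq {D : Type*} [CommRing D] [IsDomain D] [IsNoetherianRing D]
    {P : Ideal D} (hbot : P ≠ ⊥) (htop : P ≠ ⊤) : ∃ a ∈ P, a ∉ P ^ 2 := by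
  by_contra! h
  have hidem : IsIdempotentElem P := by
    rw [IsIdempotentElem, ← sq]
    exact le_antisymm (Ideal.pow_le_self two_ne_zero) h
  exact ((P.isIdempotentElem_iff_eq_bot_or_top (IsNoetherian.noetherian P)).1 hidem).elim hbot htop

/-- Pollack's theorem: if `D` is a Noetherian integral domain with infinitely many maximal
ideals, then every polynomial over `D` of degree at least one is a sum of two irreducible
elements of `D[x]`. -/
theorem goldbach_noetherian_domain (D : Type*) [CommRing D] [IsDomain D]
    [IsNoetherianRing D] (hmax : {I : Ideal D | I.IsMaximal}.Infinite)
    (f : Polynomial D) (hdeg : 1 ≤ f.natDegree) :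
    ∃ g h : Polynomial D, Irreducible g ∧ Irreducible h ∧ f = g + h := by
  obtain ⟨P, hP, Q, hQ, hPQ⟩ := hmax.nontrivial
  have hP : P.IsMaximal := hP
  have hQ : Q.IsMaximal := hQ
  have hPbot : P ≠ ⊥ := fun h ↦ hPQ (hP.eq_of_le hQ.ne_top (h ▸ bot_le))
  have hQbot : Q ≠ ⊥ := fun h ↦ hPQ (hQ.eq_of_le hP.ne_top (h ▸ bot_le)).symm
  obtain ⟨a, ha, ha2⟩ := Ideal.exists_mem_notMem_sq hPbot hP.ne_top
  obtain ⟨b, hb, hb2⟩ := Ideal.exists_mem_notMem_sq hQbot hQ.ne_top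
  have hcop : IsCoprime (P ^ 2) (Q ^ 2) :=
    (Ideal.isCoprime_iff_sup_eq.2 (hP.coprime_of_ne hQ hPQ)).pow
  obtain ⟨p, hp, q, hq, hpq⟩ := Ideal.isCoprime_iff_exists.1 hcop
  have hcP : a * q - b * p = a - p * (a + b) := by linear_combination a * hpq
  have hcQ : a * q - b * p = -b - -q * (a + b) := by linear_combination -b * hpq
  have hg := Polynomial.irreducible_X_pow_add_C_mul_add_C (c := a * q - b * p) hP.isPrime hp
    (by
      rw [hcP]
      exact P.sub_mem ha (P.mul_mem_right _ (Ideal.pow_le_self two_ne_zero hp)))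
    (by rwa [hcP, (P ^ 2).sub_mem_iff_left ((P ^ 2).mul_mem_right _ hp)]) f
  have hq' : -q ∈ Q ^ 2 := (Q ^ 2).neg_mem hq
  have hh := Polynomial.irreducible_X_pow_add_C_mul_add_C (c := a * q - b * p) hQ.isPrime hq'
    (by
      rw [hcQ]
      exact Q.sub_mem (Q.neg_mem hb) (Q.mul_mem_right _ (Ideal.pow_le_self two_ne_zero hq')))
    (by rwa [hcQ, (Q ^ 2).sub_mem_iff_left ((Q ^ 2).mul_mem_right _ hq'), neg_mem_iff]) f
  refine ⟨_, _, hg, (Associated.refl _).neg_left.irreducible_iff.2 hh, ?_⟩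
  have hC : Polynomial.C p + Polynomial.C q = 1 := by rw [← Polynomial.C_add, hpq, Polynomial.C_1]
  rw [Polynomial.C_neg]
  linear_combination -f * hC
end

section
/- If S is any integral domain and D = S[x], then every polynomial F ∈ D[y] = S[x][y] of degree d ≥ 1 (in y) can be written as F = G + H, where G and H are irreducible elements of the ring S[x][y]. -/
namespace Polynomial

theorem irreducible_X_pow_add_C_mul {R : Type*} [CommRing R] [IsDomain R] {p : R} (hp : Prime p)
    {Q : R[X]} {n : ℕ} (hQ : Q.natDegree < n) (h0 : ¬ p ∣ Q.coeff 0) :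
    Irreducible (X ^ n + C p * Q) := by
  have hlt : (C p * Q).natDegree < n := (natDegree_C_mul_le p Q).trans_lt hQ
  have hdeg : (C p * Q).degree < n := degree_le_natDegree.trans_lt (Nat.cast_lt.2 hlt)
  have hmonic : (X ^ n + C p * Q).Monic := monic_X_pow_add hdeg
  have hd : (X ^ n + C p * Q).degree = (n : WithBot ℕ) := by
    rw [degree_add_eq_left_of_degree_lt (by rwa [degree_X_pow]), degree_X_pow]
  have hprime : (Ideal.span {p}).IsPrime := (Ideal.span_singleton_prime hp.ne_zero).2 hp
  refine irreducible_of_eisenstein_criterion hprime ?_ (fun m hm ↦ ?_) ?_ ?_ hmonic.isPrimitive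
  · rw [hmonic.leadingCoeff]
    exact hprime.one_notMem
  · rw [hd, Nat.cast_lt] at hm
    simp [coeff_X_pow, hm.ne, Ideal.mem_span_singleton]
  · rw [hd]
    exact_mod_cast Nat.zero_lt_of_lt hQ
  · have hn : 0 ≠ n := (Nat.zero_lt_of_lt hQ).ne
    rw [Ideal.span_singleton_pow, Ideal.mem_span_singleton, coeff_add, coeff_X_pow, if_neg hn,
      zero_add, coeff_C_mul, sq, mul_dvd_mul_iff_left hp.ne_zero]
    exact h0

end Polynomial

open Polynomial in
/-- For any integral domain `S`, every polynomial `F ∈ S[x][y]` of degree at least one in `y`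
is a sum of two irreducible elements of `S[x][y]`. -/
theorem goldbach_poly_ring (S : Type*) [CommRing S] [IsDomain S]
    (F : Polynomial (Polynomial S)) (hdeg : 1 ≤ F.natDegree) :
    ∃ G H : Polynomial (Polynomial S), Irreducible G ∧ Irreducible H ∧ F = G + H := by
  obtain ⟨c, hc0, hc1⟩ : ∃ c : S[X],
      c.eval 0 = (F.coeff 0).eval 0 - 1 ∧ c.eval 1 = 1 - (F.coeff 0).eval 1 :=
    ⟨C ((F.coeff 0).eval 0 - 1) +
      C (1 - (F.coeff 0).eval 1 - ((F.coeff 0).eval 0 - 1)) * X, by simp, by simp⟩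
  have hX : Irreducible (X ^ (F.natDegree + 1) + C X * (F + C ((X - 1) * c))) := by
    refine irreducible_X_pow_add_C_mul prime_X (by rw [natDegree_add_C]; omega) fun h ↦ ?_
    have h := eval_dvd (x := 0) h
    simp [hc0] at h
  have hX1 : Irreducible (X ^ (F.natDegree + 1) + C (X - C 1) * (F + C (X * c))) := by
    refine irreducible_X_pow_add_C_mul (prime_X_sub_C 1) (by rw [natDegree_add_C]; omega)
      fun h ↦ ?_
    have h := eval_dvd (x := 1) h
    simp [hc1] at h
  refine ⟨_, _, hX, (Associated.refl _).neg_right.irreducible hX1, ?_⟩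
  simp only [map_mul, map_sub, map_one]
  ring
end
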